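/- arXiv:1708.01861 — 3 statements merged into one kernel-verified Lean document; each statement's English description precedes it below -/
import Mathlib

section
/- Fix integers m ≥ 1, n ≥ 1 and reals ν > m−1, σ² > 0, ρ² > 0. For every x^n = (x_1,…,x_n) ∈ (ℝ^m)^n, the supremum over μ ∈ ℝ^m and positive definite Σ ∈ ℝ^{m×m} of f(x^n;μ,Σ)·π(μ,Σ;ν,σ²,ρ²) is attained at μ = μ̄_n and Σ = Σ̄_n, i.e. f(x^n;μ,Σ)·π(μ,Σ;ν,σ²,ρ²) ≤ f(x^n;μ̄_n,Σ̄_n)·π(μ̄_n,Σ̄_n;ν,σ²,ρ²) for all μ and positive definite Σ. -/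
open MeasureTheory Matrix Real BigOperators

/-- Likelihood of `n` observations under the `m`-dimensional normal distribution
with mean `μ` and covariance `S`. -/
noncomputable def mvnLik (m n : ℕ) (x : Fin n → Fin m → ℝ) (μ : Fin m → ℝ)
    (S : Matrix (Fin m) (Fin m) ℝ) : ℝ :=
  ∏ i : Fin n, (2 * π) ^ (-(m : ℝ) / 2) * S.det ^ (-(1 : ℝ) / 2) *
    Real.exp (-(1 / 2) * ((x i - μ) ⬝ᵥ (S⁻¹ *ᵥ (x i - μ))))

/-- The simple luckiness function `π(μ, Σ; ν, σ², ρ²)`. -/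
noncomputable def luck (m : ℕ) (μ : Fin m → ℝ) (S : Matrix (Fin m) (Fin m) ℝ)
    (ν σ2 ρ2 : ℝ) : ℝ :=
  (2 * π) ^ (-(m : ℝ) * ν / 2) * S.det ^ (-ν / 2) *
    Real.exp (-(ν / 2) *
      (S⁻¹ * (σ2 • (1 : Matrix (Fin m) (Fin m) ℝ) + ρ2 • vecMulVec μ μ)).trace)

/-- The generalized luckiness function `π(μ, Σ; ν, μ₀, Σ₀, ρ²)`. -/
noncomputable def luck2 (m : ℕ) (μ : Fin m → ℝ) (S : Matrix (Fin m) (Fin m) ℝ)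
    (ν : ℝ) (μ0 : Fin m → ℝ) (S0 : Matrix (Fin m) (Fin m) ℝ) (ρ2 : ℝ) : ℝ :=
  (2 * π) ^ (-(m : ℝ) * ν / 2) * S.det ^ (-ν / 2) *
    Real.exp (-(ν / 2) *
      (S⁻¹ * (S0 + ρ2 • vecMulVec (μ - μ0) (μ - μ0))).trace)

/-- MAP location estimate `μ̄_k` for the simple luckiness. -/
noncomputable def muBar (m k : ℕ) (ν ρ2 : ℝ) (x : Fin k → Fin m → ℝ) : Fin m → ℝ :=
  (1 / (k + ρ2 * ν)) • ∑ i : Fin k, x i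

/-- MAP covariance estimate `Σ̄_k` for the simple luckiness. -/
noncomputable def sigmaBar (m k : ℕ) (ν σ2 ρ2 : ℝ) (x : Fin k → Fin m → ℝ) :
    Matrix (Fin m) (Fin m) ℝ :=
  (1 / (k + ν)) •
      (∑ i : Fin k, vecMulVec (x i) (x i) + (ν * σ2) • (1 : Matrix (Fin m) (Fin m) ℝ))
    - (1 / ((ν + k) * (ρ2 * ν + k))) • ∑ i : Fin k, ∑ j : Fin k, vecMulVec (x i) (x j)

/-- MAP location estimate `μ̄_k` for the generalized luckiness. -/
noncomputable def muBar2 (m k : ℕ) (ν ρ2 : ℝ) (μ0 : Fin m → ℝ)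
    (x : Fin k → Fin m → ℝ) : Fin m → ℝ :=
  μ0 + (1 / (k + ρ2 * ν)) • ∑ i : Fin k, (x i - μ0)

/-- MAP covariance estimate `Σ̄_k` for the generalized luckiness. -/
noncomputable def sigmaBar2 (m k : ℕ) (ν ρ2 : ℝ) (μ0 : Fin m → ℝ)
    (S0 : Matrix (Fin m) (Fin m) ℝ) (x : Fin k → Fin m → ℝ) : Matrix (Fin m) (Fin m) ℝ :=
  (1 / (k + ν)) • (∑ i : Fin k, vecMulVec (x i - μ0) (x i - μ0) + ν • S0)
    - (1 / ((ν + k) * (ρ2 * ν + k))) •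
        ∑ i : Fin k, ∑ j : Fin k, vecMulVec (x i - μ0) (x j - μ0)

/-- The multivariate gamma function `Γ_m(z)`. -/
noncomputable def multiGamma (m : ℕ) (z : ℝ) : ℝ :=
  π ^ ((m : ℝ) * ((m : ℝ) - 1) / 4) * ∏ j : Fin m, Real.Gamma (z - (j : ℝ) / 2)

/-- The capacity `𝒞(m, n, ν, σ², ρ²)` (note: the fourth argument is `σ²`,
so `σ^{-mν} = (σ²)^{-mν/2}`). -/
noncomputable def capC (m n : ℕ) (ν σ2 ρ2 : ℝ) : ℝ :=
  σ2 ^ (-(m : ℝ) * ν / 2) *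
    ((((n : ℝ) + ν) ^ ((n : ℝ) + ν) * (1 + n / (ρ2 * ν))) /
        ((2 * Real.exp 1) ^ ((n : ℝ) + ν) * (π * ν) ^ ν)) ^ ((m : ℝ) / 2) *
    (multiGamma m (ν / 2) / multiGamma m (((n : ℝ) + ν) / 2))

/-- The pointwise supremum of likelihood times simple luckiness over all `μ`
and positive definite `Σ`. -/
noncomputable def supLik (m n : ℕ) (ν σ2 ρ2 : ℝ) (x : Fin n → Fin m → ℝ) : ℝ :=
  ⨆ p : (Fin m → ℝ) × {S : Matrix (Fin m) (Fin m) ℝ // S.PosDef},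
    mvnLik m n x p.1 p.2.1 * luck m p.1 p.2.1 ν σ2 ρ2

/-- The pointwise supremum of likelihood times generalized luckiness over all `μ`
and positive definite `Σ`. -/
noncomputable def supLik2 (m n : ℕ) (ν : ℝ) (μ0 : Fin m → ℝ)
    (S0 : Matrix (Fin m) (Fin m) ℝ) (ρ2 : ℝ) (x : Fin n → Fin m → ℝ) : ℝ :=
  ⨆ p : (Fin m → ℝ) × {S : Matrix (Fin m) (Fin m) ℝ // S.PosDef},
    mvnLik m n x p.1 p.2.1 * luck2 m p.1 p.2.1 ν μ0 S0 ρ2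

/-- The density of the `m`-variate Student t-distribution with `d` degrees of
freedom, location `μ` and scale matrix `S`. -/
noncomputable def tDens (m : ℕ) (d : ℝ) (x μ : Fin m → ℝ)
    (S : Matrix (Fin m) (Fin m) ℝ) : ℝ :=
  Real.Gamma ((d + m) / 2) /
      (Real.Gamma (d / 2) * (d * π) ^ ((m : ℝ) / 2) * S.det ^ ((1 : ℝ) / 2)) *
    (1 + (1 / d) * ((x - μ) ⬝ᵥ (S⁻¹ *ᵥ (x - μ)))) ^ (-(d + (m : ℝ)) / 2)

open scoped MatrixOrder Matrix.Norms.L2Operator in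
/-- A positive semidefinite matrix is a Gram matrix. -/
theorem Matrix.PosSemidef.exists_conjTranspose_mul_self {ι : Type*} [Fintype ι] [DecidableEq ι]
    {A : Matrix ι ι ℝ} (hA : A.PosSemidef) : ∃ B : Matrix ι ι ℝ, A = Bᴴ * B := by
  obtain ⟨B, hB⟩ := CStarAlgebra.nonneg_iff_eq_star_mul_self.mp hA.nonneg
  exact ⟨B, hB⟩

/-- The determinant of a positive semidefinite matrix is bounded by the exponential of its trace
minus the dimension. -/
theorem Matrix.PosSemidef.det_le_exp_trace_sub_card {ι : Type*} [Fintype ι] [DecidableEq ι]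
    {A : Matrix ι ι ℝ} (hA : A.PosSemidef) :
    A.det ≤ Real.exp (A.trace - Fintype.card ι) := by
  have hdet : A.det = ∏ i, hA.1.eigenvalues i := by
    simpa using hA.1.det_eq_prod_eigenvalues
  have htrace : A.trace = ∑ i, hA.1.eigenvalues i := by
    simpa using hA.1.trace_eq_sum_eigenvalues
  have hsum : A.trace - Fintype.card ι = ∑ i, (hA.1.eigenvalues i - 1) := by
    simp [htrace]
  rw [hsum, Real.exp_sum, hdet]
  refine Finset.prod_le_prod (fun i _ => hA.eigenvalues_nonneg i) fun i _ => ?_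
  simpa using Real.add_one_le_exp (hA.1.eigenvalues i - 1)

/-- The same bound for a product of two positive semidefinite matrices. -/
theorem Matrix.PosSemidef.det_mul_le_exp_trace_mul_sub_card {ι : Type*} [Fintype ι]
    [DecidableEq ι] {A C : Matrix ι ι ℝ} (hA : A.PosSemidef) (hC : C.PosSemidef) :
    (A * C).det ≤ Real.exp ((A * C).trace - Fintype.card ι) := by
  obtain ⟨B, rfl⟩ := hA.exists_conjTranspose_mul_self
  have h := (hC.mul_mul_conjTranspose_same B).det_le_exp_trace_sub_card
  have hdet : (Bᴴ * B * C).det = (B * C * Bᴴ).det := by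
    simp only [Matrix.det_mul]; ring
  have htrace : (Bᴴ * B * C).trace = (B * C * Bᴴ).trace := by
    rw [Matrix.mul_assoc, Matrix.trace_mul_comm]
  rwa [hdet, htrace]

/-- As a function of `S`, the expression `|S|^(-N/2) exp(-(N/2) tr(S⁻¹ T))` is maximal
at `S = T`. -/
theorem Matrix.PosDef.det_rpow_mul_exp_le {ι : Type*} [Fintype ι] [DecidableEq ι]
    {S T : Matrix ι ι ℝ} (hS : S.PosDef) (hT : T.PosDef) {N : ℝ} (hN : 0 ≤ N) :
    S.det ^ (-N / 2) * Real.exp (-(N / 2) * (S⁻¹ * T).trace) ≤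
      T.det ^ (-N / 2) * Real.exp (-(N / 2) * (T⁻¹ * T).trace) := by
  have h := hS.inv.posSemidef.det_mul_le_exp_trace_mul_sub_card hT.posSemidef
  have hSd := hS.det_pos
  have hTd := hT.det_pos
  have hTT : (T⁻¹ * T).trace = Fintype.card ι := by
    rw [Matrix.nonsing_inv_mul _ hTd.ne'.isUnit, Matrix.trace_one]
  rw [Matrix.det_mul, Matrix.det_nonsing_inv, Ring.inverse_eq_inv',
    ← Real.log_le_iff_le_exp (by positivity), Real.log_mul (by positivity) hTd.ne',
    Real.log_inv] at h
  rw [hTT, Real.rpow_def_of_pos hSd, Real.rpow_def_of_pos hTd, ← Real.exp_add, ← Real.exp_add]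
  refine Real.exp_le_exp.mpr ?_
  nlinarith

/-- The scatter matrix of the data around `μ`, including the contribution of the luckiness. -/
noncomputable def scatter (m n : ℕ) (ν σ2 ρ2 : ℝ) (x : Fin n → Fin m → ℝ) (μ : Fin m → ℝ) :
    Matrix (Fin m) (Fin m) ℝ :=
  ∑ i, vecMulVec (x i - μ) (x i - μ) +
    ν • (σ2 • (1 : Matrix (Fin m) (Fin m) ℝ) + ρ2 • vecMulVec μ μ)

/-- Likelihood times luckiness depends on the data only through the scatter matrix. -/
theorem mvnLik_mul_luck (m n : ℕ) (ν σ2 ρ2 : ℝ) (x : Fin n → Fin m → ℝ) (μ : Fin m → ℝ)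
    {S : Matrix (Fin m) (Fin m) ℝ} (hS : 0 < S.det) :
    mvnLik m n x μ S * luck m μ S ν σ2 ρ2 =
      (2 * π) ^ (-(m : ℝ) * (n + ν) / 2) * (S.det ^ (-(n + ν) / 2) *
        Real.exp (-(1 / 2) * (S⁻¹ * scatter m n ν σ2 ρ2 x μ).trace)) := by
  have hπ : (0 : ℝ) < 2 * π := by positivity
  have hquad (v : Fin m → ℝ) : v ⬝ᵥ (S⁻¹ *ᵥ v) = (S⁻¹ * vecMulVec v v).trace := by
    rw [mul_vecMulVec, trace_vecMulVec, dotProduct_comm]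
  have htrace : (S⁻¹ * scatter m n ν σ2 ρ2 x μ).trace =
      ∑ i, (S⁻¹ * vecMulVec (x i - μ) (x i - μ)).trace +
        ν * (S⁻¹ * (σ2 • (1 : Matrix (Fin m) (Fin m) ℝ) + ρ2 • vecMulVec μ μ)).trace := by
    rw [scatter, Matrix.mul_add, Matrix.trace_add, Matrix.mul_sum, Matrix.trace_sum,
      Matrix.mul_smul, Matrix.trace_smul, smul_eq_mul]
  simp only [mvnLik, luck, hquad, htrace, Real.rpow_def_of_pos hπ, Real.rpow_def_of_pos hS,
    ← Real.exp_add, ← Real.exp_sum, Finset.sum_add_distrib, ← Finset.mul_sum, Finset.sum_const,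
    Finset.card_univ, Fintype.card_fin, nsmul_eq_mul]
  congr 1
  ring

/-- Completing the square: the scatter matrix around `μ` in terms of the MAP estimates. -/
theorem scatter_eq (m n : ℕ) {ν ρ2 : ℝ} (σ2 : ℝ) (hν : 0 < ν) (hρ : 0 < ρ2)
    (x : Fin n → Fin m → ℝ) (μ : Fin m → ℝ) :
    scatter m n ν σ2 ρ2 x μ = ((n : ℝ) + ν) • sigmaBar m n ν σ2 ρ2 x +
      ((n : ℝ) + ρ2 * ν) • vecMulVec (μ - muBar m n ν ρ2 x) (μ - muBar m n ν ρ2 x) := by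
  have hN : (n : ℝ) + ν ≠ 0 := by positivity
  have hN' : ν + (n : ℝ) ≠ 0 := by positivity
  have hR : (n : ℝ) + ρ2 * ν ≠ 0 := by positivity
  have hR' : ρ2 * ν + (n : ℝ) ≠ 0 := by positivity
  ext a b
  simp only [scatter, sigmaBar, muBar, Matrix.add_apply, Matrix.sub_apply, Matrix.smul_apply,
    Matrix.sum_apply, vecMulVec_apply, Pi.sub_apply, Pi.smul_apply, Finset.sum_apply,
    smul_eq_mul, sub_mul, mul_sub, Finset.sum_sub_distrib, ← Finset.mul_sum, ← Finset.sum_mul,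
    Finset.sum_const, Finset.card_univ, Fintype.card_fin, nsmul_eq_mul]
  field_simp
  ring

/-- The MAP covariance estimate is positive definite. -/
theorem sigmaBar_posDef (m n : ℕ) {ν σ2 ρ2 : ℝ} (hν : 0 < ν) (hσ : 0 < σ2) (hρ : 0 < ρ2)
    (x : Fin n → Fin m → ℝ) : (sigmaBar m n ν σ2 ρ2 x).PosDef := by
  have hN : 0 < (n : ℝ) + ν := by positivity
  have hvec (v : Fin m → ℝ) : (vecMulVec v v).PosSemidef := by
    simpa using posSemidef_vecMulVec_self_star v
  have hscatter : (scatter m n ν σ2 ρ2 x (muBar m n ν ρ2 x)).PosDef :=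
    PosDef.posSemidef_add (posSemidef_sum _ fun i _ => hvec _)
      (((PosDef.one.smul hσ).add_posSemidef ((hvec _).smul hρ.le)).smul hν)
  rw [scatter_eq m n σ2 hν hρ, sub_self, zero_vecMulVec, smul_zero, add_zero] at hscatter
  simpa [smul_smul, hN.ne'] using hscatter.smul (inv_pos.mpr hN)

/-- the supremum of likelihood times luckiness is attained at the
MAP estimates `μ̄_n`, `Σ̄_n`. -/
theorem lnml_sup_attained (m n : ℕ) (hm : 1 ≤ m) (hn : 1 ≤ n) (ν σ2 ρ2 : ℝ)
    (hν : (m : ℝ) - 1 < ν) (hσ : 0 < σ2) (hρ : 0 < ρ2)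
    (x : Fin n → Fin m → ℝ) (μ : Fin m → ℝ) (S : Matrix (Fin m) (Fin m) ℝ)
    (hS : S.PosDef) :
    mvnLik m n x μ S * luck m μ S ν σ2 ρ2 ≤
      mvnLik m n x (muBar m n ν ρ2 x) (sigmaBar m n ν σ2 ρ2 x) *
        luck m (muBar m n ν ρ2 x) (sigmaBar m n ν σ2 ρ2 x) ν σ2 ρ2 := by
  have hν0 : 0 < ν := by
    have : (1 : ℝ) ≤ m := by exact_mod_cast hm
    linarith
  have hN : 0 < (n : ℝ) + ν := by positivity
  have hT := sigmaBar_posDef m n hν0 hσ hρ x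
  have hexp (R : Matrix (Fin m) (Fin m) ℝ) :
      -(1 / 2) * (R⁻¹ * (((n : ℝ) + ν) • sigmaBar m n ν σ2 ρ2 x)).trace =
        -((n + ν) / 2) * (R⁻¹ * sigmaBar m n ν σ2 ρ2 x).trace := by
    rw [Matrix.mul_smul, Matrix.trace_smul, smul_eq_mul]
    ring
  have hquad : 0 ≤ (S⁻¹ * vecMulVec (μ - muBar m n ν ρ2 x) (μ - muBar m n ν ρ2 x)).trace := by
    rw [mul_vecMulVec, trace_vecMulVec, dotProduct_comm]
    simpa using hS.inv.posSemidef.dotProduct_mulVec_nonneg (μ - muBar m n ν ρ2 x)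
  rw [mvnLik_mul_luck m n ν σ2 ρ2 x μ hS.det_pos, mvnLik_mul_luck m n ν σ2 ρ2 x _ hT.det_pos,
    scatter_eq m n σ2 hν0 hρ, scatter_eq m n σ2 hν0 hρ, sub_self, zero_vecMulVec, smul_zero,
    add_zero, hexp]
  refine mul_le_mul_of_nonneg_left (le_trans ?_ (hS.det_rpow_mul_exp_le hT hN.le)) (by positivity)
  refine mul_le_mul_of_nonneg_left (Real.exp_le_exp.mpr ?_) (Real.rpow_nonneg hS.det_pos.le _)
  rw [← hexp, Matrix.mul_add, Matrix.trace_add, Matrix.mul_smul _ ((n : ℝ) + ρ2 * ν),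
    Matrix.trace_smul _ (_ * vecMulVec _ _), smul_eq_mul]
  have : 0 ≤ ((n : ℝ) + ρ2 * ν) *
      (S⁻¹ * vecMulVec (μ - muBar m n ν ρ2 x) (μ - muBar m n ν ρ2 x)).trace := by positivity
  linarith
end

section
/- Fix integers m ≥ 1, n ≥ 1 and reals ν > 0, σ² > 0, ρ² > 0. For every x^n = (x_1,…,x_n) ∈ (ℝ^m)^n, the MAP covariance estimates satisfy the recursion Σ̄_n = ((ν+n−1)/(ν+n))·Σ̄_{n−1} + ((ρ²ν+n−1)/((ν+n)(ρ²ν+n)))·(x_n−μ̄_{n−1})(x_n−μ̄_{n−1})ᵀ, where Σ̄_{n−1} and μ̄_{n−1} are computed from the first n−1 observations. -/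
open MeasureTheory Matrix Real BigOperators

theorem muBar_apply (m k : ℕ) (ν ρ2 : ℝ) (x : Fin k → Fin m → ℝ) (a : Fin m) :
    muBar m k ν ρ2 x a = 1 / (k + ρ2 * ν) * ∑ i, x i a := by
  simp [muBar]

theorem sigmaBar_apply (m k : ℕ) (ν σ2 ρ2 : ℝ) (x : Fin k → Fin m → ℝ) (a b : Fin m) :
    sigmaBar m k ν σ2 ρ2 x a b =
      1 / (k + ν) * (∑ i, x i a * x i b + ν * σ2 * (1 : Matrix (Fin m) (Fin m) ℝ) a b)
        - 1 / ((ν + k) * (ρ2 * ν + k)) * ((∑ i, x i a) * ∑ j, x j b) := by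
  rw [Finset.sum_mul_sum]
  simp only [sigmaBar, Matrix.sub_apply, Matrix.smul_apply, Matrix.add_apply, Matrix.sum_apply,
    vecMulVec_apply, smul_eq_mul]

theorem sigmaBar_succ (m k : ℕ) {ν ρ2 : ℝ} (σ2 : ℝ) (hν : 0 < ν) (hρ : 0 < ρ2)
    (x : Fin (k + 1) → Fin m → ℝ) :
    sigmaBar m (k + 1) ν σ2 ρ2 x =
      ((ν + (k + 1 : ℕ) - 1) / (ν + (k + 1 : ℕ))) •
          sigmaBar m k ν σ2 ρ2 (fun i => x i.castSucc)
        + ((ρ2 * ν + (k + 1 : ℕ) - 1) / ((ν + (k + 1 : ℕ)) * (ρ2 * ν + (k + 1 : ℕ)))) •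
            vecMulVec
              (x (Fin.last k) - muBar m k ν ρ2 (fun i => x i.castSucc))
              (x (Fin.last k) - muBar m k ν ρ2 (fun i => x i.castSucc)) := by
  ext a b
  rw [sigmaBar_apply, Matrix.add_apply, Matrix.smul_apply, Matrix.smul_apply, sigmaBar_apply,
    vecMulVec_apply, Pi.sub_apply, Pi.sub_apply, muBar_apply, muBar_apply]
  simp only [Fin.sum_univ_castSucc, smul_eq_mul]
  generalize ∑ i : Fin k, x i.castSucc a * x i.castSucc b = P
  generalize ∑ i : Fin k, x i.castSucc a = A
  generalize ∑ i : Fin k, x i.castSucc b = B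
  generalize (1 : Matrix (Fin m) (Fin m) ℝ) a b = δ
  generalize x (Fin.last k) a = u
  generalize x (Fin.last k) b = v
  push_cast
  have h₁ : (k : ℝ) + ν ≠ 0 := by positivity
  have h₂ : (k : ℝ) + ρ2 * ν ≠ 0 := by positivity
  have h₃ : (k : ℝ) + 1 + ν ≠ 0 := by positivity
  have h₄ : (k : ℝ) + 1 + ρ2 * ν ≠ 0 := by positivity
  rw [show ν + (k + 1) - 1 = (k : ℝ) + ν by ring,
    show ρ2 * ν + (k + 1) - 1 = (k : ℝ) + ρ2 * ν by ring,
    show ν + (k + 1) = (k : ℝ) + 1 + ν by ring,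
    show ρ2 * ν + (k + 1) = (k : ℝ) + 1 + ρ2 * ν by ring,
    show ν + k = (k : ℝ) + ν by ring, show ρ2 * ν + k = (k : ℝ) + ρ2 * ν by ring]
  field_simp
  ring

/-- recursion for the MAP covariance estimates. -/
theorem sigmaBar_recursion (m n : ℕ) (hm : 1 ≤ m) (hn : 1 ≤ n) (ν σ2 ρ2 : ℝ)
    (hν : 0 < ν) (hσ : 0 < σ2) (hρ : 0 < ρ2)
    (x : Fin n → Fin m → ℝ) :
    sigmaBar m n ν σ2 ρ2 x =
      ((ν + n - 1) / (ν + n)) •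
          sigmaBar m (n - 1) ν σ2 ρ2 (fun i => x (Fin.castLE (Nat.sub_le n 1) i))
        + ((ρ2 * ν + n - 1) / ((ν + n) * (ρ2 * ν + n))) •
            vecMulVec
              (x ⟨n - 1, by omega⟩ -
                muBar m (n - 1) ν ρ2 (fun i => x (Fin.castLE (Nat.sub_le n 1) i)))
              (x ⟨n - 1, by omega⟩ -
                muBar m (n - 1) ν ρ2 (fun i => x (Fin.castLE (Nat.sub_le n 1) i))) := by
  obtain ⟨k, rfl⟩ : ∃ k, n = k + 1 := ⟨n - 1, by omega⟩
  exact sigmaBar_succ m k σ2 hν hρ x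
end

section
/- Fix integers m ≥ 1, n ≥ 1 and reals ν > m−1, σ² > 0, ρ² > 0. Then ∫_{(ℝ^m)^n} |Σ̄_n|^{−(ν+n)/2} dx^n = Γ_m(ν/2)·π^{mn/2}·(ν+n)^{m(ν+n)/2}·(1+n/(ρ²ν))^{m/2} / (σ^{mν}·Γ_m((ν+n)/2)·ν^{mν/2}), where the integral is over all x^n = (x_1,…,x_n) ∈ (ℝ^m)^n. -/
open MeasureTheory Matrix Real BigOperators

theorem lintegral_exp_neg_mul_dotProduct_self (m : ℕ) {b : ℝ} (hb : 0 < b) :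
    ∫⁻ y : Fin m → ℝ, ENNReal.ofReal (Real.exp (-b * (y ⬝ᵥ y)))
      = ENNReal.ofReal ((π / b) ^ ((m : ℝ) / 2)) := by
  have hprod : ∀ y : Fin m → ℝ,
      Real.exp (-b * (y ⬝ᵥ y)) = ∏ i, Real.exp (-b * (y i) ^ 2) := fun y => by
    rw [← Real.exp_sum, ← Finset.mul_sum]
    simp [dotProduct, sq]
  simp_rw [hprod]
  rw [← ofReal_integral_eq_lintegral_ofReal, integral_fintype_prod_volume_eq_pow
    (fun t : ℝ => Real.exp (-b * t ^ 2)), integral_gaussian, Fintype.card_fin,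
    Real.sqrt_eq_rpow, ← Real.rpow_natCast, ← Real.rpow_mul (by positivity)]
  · congr 2; ring
  · exact Integrable.fintype_prod (f := fun _ t => Real.exp (-b * t ^ 2))
      fun _ => integrable_exp_neg_mul_sq hb
  · exact Filter.Eventually.of_forall fun y => Finset.prod_nonneg fun i _ => (Real.exp_pos _).le

theorem lintegral_rpow_mul_exp_neg_mul_Ioi {a b : ℝ} (ha : 0 < a) (hb : 0 < b) :
    ∫⁻ t in Set.Ioi (0 : ℝ), ENNReal.ofReal (t ^ (a - 1) * Real.exp (-(b * t)))
      = ENNReal.ofReal (b ^ (-a) * Real.Gamma a) := by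
  have hI := Real.integral_rpow_mul_exp_neg_mul_Ioi ha hb
  have hG := Real.Gamma_pos_of_pos ha
  rw [← ofReal_integral_eq_lintegral_ofReal, hI, one_div, Real.inv_rpow hb.le,
    Real.rpow_neg hb.le]
  · refine not_imp_comm.1 integral_undef ?_
    rw [hI]
    positivity
  · filter_upwards [ae_restrict_mem measurableSet_Ioi] with t ht
    have : (0 : ℝ) < t := ht
    simp only [Pi.zero_apply]
    positivity

theorem lintegral_one_add_mul_dotProduct_self_rpow (m : ℕ) {c s : ℝ} (hc : 0 < c)
    (hs : (m : ℝ) / 2 < s) :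
    ∫⁻ y : Fin m → ℝ, ENNReal.ofReal ((1 + c * (y ⬝ᵥ y)) ^ (-s))
      = ENNReal.ofReal (c ^ (-(m : ℝ) / 2) * π ^ ((m : ℝ) / 2) *
          (Real.Gamma (s - m / 2) / Real.Gamma s)) := by
  have hs0 : 0 < s := lt_of_le_of_lt (by positivity) hs
  have hG := Real.Gamma_pos_of_pos hs0
  have hG' := Real.Gamma_pos_of_pos (sub_pos.2 hs)
  have hq : ∀ y : Fin m → ℝ, 0 ≤ y ⬝ᵥ y := fun y => by
    simpa using dotProduct_star_self_nonneg y
  have hrep : ∀ y : Fin m → ℝ, ENNReal.ofReal ((1 + c * (y ⬝ᵥ y)) ^ (-s))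
      = ENNReal.ofReal (1 / Real.Gamma s) * ∫⁻ t in Set.Ioi (0 : ℝ),
        ENNReal.ofReal (t ^ (s - 1) * Real.exp (-((1 + c * (y ⬝ᵥ y)) * t))) := fun y => by
    have := hq y
    rw [lintegral_rpow_mul_exp_neg_mul_Ioi hs0 (by positivity),
      ← ENNReal.ofReal_mul (by positivity)]
    congr 1
    field_simp
  simp_rw [hrep]
  have hmeas : Measurable (fun p : (Fin m → ℝ) × ℝ =>
      ENNReal.ofReal (p.2 ^ (s - 1) * Real.exp (-((1 + c * (p.1 ⬝ᵥ p.1)) * p.2)))) := by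
    unfold dotProduct
    fun_prop
  rw [lintegral_const_mul', lintegral_lintegral_swap hmeas.aemeasurable]
  · have hinner : ∀ t ∈ Set.Ioi (0 : ℝ), ∫⁻ y : Fin m → ℝ,
        ENNReal.ofReal (t ^ (s - 1) * Real.exp (-((1 + c * (y ⬝ᵥ y)) * t)))
        = ENNReal.ofReal ((π / c) ^ ((m : ℝ) / 2)) *
          ENNReal.ofReal (t ^ (s - m / 2 - 1) * Real.exp (-(1 * t))) := fun t ht => by
      have ht : 0 < t := ht
      have hsplit : ∀ y : Fin m → ℝ,
          ENNReal.ofReal (t ^ (s - 1) * Real.exp (-((1 + c * (y ⬝ᵥ y)) * t)))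
          = ENNReal.ofReal (t ^ (s - 1) * Real.exp (-t)) *
            ENNReal.ofReal (Real.exp (-(c * t) * (y ⬝ᵥ y))) := fun y => by
        rw [← ENNReal.ofReal_mul (by positivity), mul_assoc, ← Real.exp_add]
        congr 3
        ring
      simp_rw [hsplit]
      rw [lintegral_const_mul' _ _ ENNReal.ofReal_ne_top,
        lintegral_exp_neg_mul_dotProduct_self m (by positivity),
        ← ENNReal.ofReal_mul (by positivity), ← ENNReal.ofReal_mul (by positivity)]
      congr 1
      rw [show s - (m : ℝ) / 2 - 1 = (s - 1) - m / 2 by ring, Real.rpow_sub ht (s - 1),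
        Real.div_rpow (by positivity) (by positivity), Real.mul_rpow hc.le ht.le,
        Real.div_rpow (by positivity) (by positivity), one_mul]
      have hc' : c ^ ((m : ℝ) / 2) ≠ 0 := by positivity
      have ht' : t ^ ((m : ℝ) / 2) ≠ 0 := by positivity
      generalize t ^ (s - 1) = p
      field_simp
    rw [setLIntegral_congr_fun measurableSet_Ioi hinner,
      lintegral_const_mul' _ _ ENNReal.ofReal_ne_top,
      lintegral_rpow_mul_exp_neg_mul_Ioi (sub_pos.2 hs) one_pos,
      ← ENNReal.ofReal_mul (by positivity), ← ENNReal.ofReal_mul (by positivity)]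
    congr 1
    rw [Real.div_rpow (by positivity) (by positivity), Real.one_rpow, neg_div,
      Real.rpow_neg hc.le]
    field_simp
  · exact ENNReal.ofReal_ne_top

theorem lintegral_det_add_smul_vecMulVec_rpow {m : ℕ} {A : Matrix (Fin m) (Fin m) ℝ}
    (hA : A.PosDef) {c s : ℝ} (hc : 0 < c) (hs : (m : ℝ) / 2 < s) (v : Fin m → ℝ) :
    ∫⁻ x : Fin m → ℝ, ENNReal.ofReal ((A + c • vecMulVec (x - v) (x - v)).det ^ (-s))
      = ENNReal.ofReal (c ^ (-(m : ℝ) / 2) * π ^ ((m : ℝ) / 2) *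
          (Real.Gamma (s - m / 2) / Real.Gamma s)) *
        ENNReal.ofReal (A.det ^ (1 / 2 - s)) := by
  rw [lintegral_sub_right_eq_self
    (fun x => ENNReal.ofReal ((A + c • vecMulVec x x).det ^ (-s))) v]
  have hdet : 0 < A.det := hA.det_pos
  obtain ⟨B, hB⟩ : ∃ B : Matrix (Fin m) (Fin m) ℝ, A = Bᵀ * B := by
    open scoped MatrixOrder in
    obtain ⟨B, hB⟩ := CStarAlgebra.nonneg_iff_eq_star_mul_self.mp hA.posSemidef.nonneg
    exact ⟨B, by simpa [star_eq_conjTranspose] using hB⟩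
  have hdetB : A.det = B.det * B.det := by rw [hB, det_mul, det_transpose]
  have hB0 : Bᵀ.det ≠ 0 := by
    rw [det_transpose]
    rintro h
    simp [h] at hdetB
    exact hdet.ne' hdetB
  have hmap := Real.map_matrix_volume_pi_eq_smul_volume_pi hB0
  have hvol : (volume : Measure (Fin m → ℝ)) =
      ENNReal.ofReal |Bᵀ.det| • Measure.map (toLin' Bᵀ) volume := by
    rw [hmap, smul_smul, ← ENNReal.ofReal_mul (abs_nonneg _), ← abs_mul, mul_inv_cancel₀ hB0]
    simp
  have hfm : Measurable fun x : Fin m → ℝ =>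
      ENNReal.ofReal ((A + c • vecMulVec x x).det ^ (-s)) := by
    have : Continuous fun x : Fin m → ℝ => (A + c • vecMulVec x x).det := by fun_prop
    have := this.measurable
    fun_prop
  have hpt : ∀ y : Fin m → ℝ,
      ENNReal.ofReal ((A + c • vecMulVec (toLin' Bᵀ y) (toLin' Bᵀ y)).det ^ (-s))
      = ENNReal.ofReal (A.det ^ (-s)) * ENNReal.ofReal ((1 + c * (y ⬝ᵥ y)) ^ (-s)) := fun y => by
    have hy : 0 ≤ y ⬝ᵥ y := by simpa using dotProduct_star_self_nonneg y
    rw [← ENNReal.ofReal_mul (by positivity), ← Real.mul_rpow hdet.le (by positivity)]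
    congr 2
    have : A + c • vecMulVec (toLin' Bᵀ y) (toLin' Bᵀ y)
        = Bᵀ * (1 + replicateCol Unit (c • y) * replicateRow Unit y) * B := by
      rw [Matrix.mul_add, Matrix.add_mul, Matrix.mul_one, ← hB, ← vecMulVec_eq,
        mul_vecMulVec, vecMulVec_mul, mulVec_smul, smul_vecMulVec, toLin'_apply,
        mulVec_transpose]
    rw [this, det_mul, det_mul, det_one_add_replicateCol_mul_replicateRow, hdetB, det_transpose,
      dotProduct_smul, smul_eq_mul]
    ring
  conv_lhs => rw [hvol]
  rw [lintegral_smul_measure, lintegral_map hfm (by fun_prop)]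
  simp_rw [hpt]
  rw [lintegral_const_mul' _ _ ENNReal.ofReal_ne_top,
    lintegral_one_add_mul_dotProduct_self_rpow m hc hs, smul_eq_mul, ← mul_assoc,
    ← ENNReal.ofReal_mul (abs_nonneg _), mul_comm]
  congr 2
  rw [det_transpose, sub_eq_add_neg, Real.rpow_add hdet, ← Real.sqrt_eq_rpow, hdetB,
    Real.sqrt_mul_self_eq_abs]

theorem posDef_smul_one_add_sum_vecMulVec_sub {m n : ℕ} {a t : ℝ} (ha : 0 < a) (ht : 0 ≤ t)
    (hnt : n * t < 1) (x : Fin n → Fin m → ℝ) :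
    (a • (1 : Matrix (Fin m) (Fin m) ℝ) + ∑ i, vecMulVec (x i) (x i)
      - t • vecMulVec (∑ i, x i) (∑ i, x i)).PosDef := by
  have hsymm : ∀ v : Fin m → ℝ, (vecMulVec v v).IsHermitian := fun v =>
    (posSemidef_vecMulVec_self_star v).isHermitian
  rw [add_sub_assoc]
  refine (Matrix.PosDef.one.smul ha).add_posSemidef (.of_dotProduct_mulVec_nonneg ?_ fun w => ?_)
  · refine IsHermitian.sub (isSelfAdjoint_sum _ fun i _ => hsymm (x i)) ?_
    exact IsSelfAdjoint.smul (IsSelfAdjoint.all t) (hsymm _)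
  · have hquad : ∀ v : Fin m → ℝ, w ⬝ᵥ (vecMulVec v v *ᵥ w) = (w ⬝ᵥ v) ^ 2 := fun v => by
      rw [vecMulVec_mulVec, dotProduct_comm v w]
      simp [sq]
    have hcs := sq_sum_le_card_mul_sum_sq (s := Finset.univ) (f := fun i => w ⬝ᵥ x i)
    have hsq : 0 ≤ ∑ i, (w ⬝ᵥ x i) ^ 2 := Finset.sum_nonneg fun i _ => sq_nonneg _
    rw [Finset.card_univ, Fintype.card_fin] at hcs
    rw [star_trivial, sub_mulVec, sum_mulVec, smul_mulVec, dotProduct_sub, dotProduct_sum,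
      dotProduct_smul, hquad, dotProduct_sum]
    simp_rw [hquad]
    rw [smul_eq_mul, sub_nonneg]
    calc t * (∑ i, w ⬝ᵥ x i) ^ 2 ≤ t * (n * ∑ i, (w ⬝ᵥ x i) ^ 2) := by gcongr
      _ = n * t * ∑ i, (w ⬝ᵥ x i) ^ 2 := by ring
      _ ≤ 1 * ∑ i, (w ⬝ᵥ x i) ^ 2 := by gcongr
      _ = _ := one_mul _

theorem vecMulVec_self_sub_smul_vecMulVec_add {m : ℕ} {t : ℝ} (ht : t < 1) (x y : Fin m → ℝ) :
    vecMulVec x x - t • vecMulVec (x + y) (x + y)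
      = (1 - t) • vecMulVec (x - (t / (1 - t)) • y) (x - (t / (1 - t)) • y)
        - (t / (1 - t)) • vecMulVec y y := by
  have : 1 - t ≠ 0 := (sub_pos.2 ht).ne'
  ext i j
  simp only [Matrix.sub_apply, Matrix.smul_apply, vecMulVec_apply, Pi.add_apply, Pi.sub_apply, Pi.smul_apply,
    smul_eq_mul]
  field_simp
  ring

theorem lintegral_det_smul_one_add_sum_vecMulVec_sub_rpow (m : ℕ) {ν a : ℝ}
    (hν : (m : ℝ) - 1 < ν) (ha : 0 < a) (n : ℕ) : ∀ {t : ℝ}, 0 ≤ t → n * t < 1 →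
    ∫⁻ x : Fin n → Fin m → ℝ, ENNReal.ofReal
      ((a • (1 : Matrix (Fin m) (Fin m) ℝ) + ∑ i, vecMulVec (x i) (x i)
        - t • vecMulVec (∑ i, x i) (∑ i, x i)).det ^ (-((ν + n) / 2)))
      = ENNReal.ofReal (a ^ (-((m : ℝ) * ν / 2)) * (1 - n * t) ^ (-(m : ℝ) / 2) *
          ((π ^ ((m : ℝ) / 2)) ^ n * ∏ k ∈ Finset.range n,
            Real.Gamma ((ν + k + 1) / 2 - m / 2) / Real.Gamma ((ν + k + 1) / 2))) := by
  induction n with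
  | zero =>
    intro t _ _
    rw [Measure.volume_pi_eq_dirac 0, lintegral_dirac]
    simp only [Finset.univ_eq_empty, Finset.sum_empty, vecMulVec_zero, smul_zero, add_zero,
      sub_zero, det_smul, det_one, Fintype.card_fin, CharP.cast_eq_zero, Finset.range_zero,
      Finset.prod_empty, zero_mul, Real.one_rpow, pow_zero, mul_one]
    rw [← Real.rpow_natCast, ← Real.rpow_mul ha.le]
    congr 2
    ring
  | succ n ih =>
    intro t ht hnt
    push_cast at hnt
    have hnt0 : 0 ≤ n * t := by positivity
    have ht1 : t < 1 := by linarith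
    have h1t : 0 < 1 - t := sub_pos.2 ht1
    have ht' : 0 ≤ t / (1 - t) := by positivity
    have hnt' : n * (t / (1 - t)) < 1 := by
      rw [← mul_div_assoc, div_lt_one h1t]
      linarith
    have hs : (m : ℝ) / 2 < (ν + n + 1) / 2 := by
      have : (0 : ℝ) ≤ n := n.cast_nonneg
      linarith
    have hmeas : Measurable fun x : Fin (n + 1) → Fin m → ℝ => ENNReal.ofReal
        ((a • (1 : Matrix (Fin m) (Fin m) ℝ) + ∑ i, vecMulVec (x i) (x i)
          - t • vecMulVec (∑ i, x i) (∑ i, x i)).det ^ (-((ν + (n + 1 : ℕ)) / 2))) := by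
      have : Continuous fun x : Fin (n + 1) → Fin m → ℝ =>
          (a • (1 : Matrix (Fin m) (Fin m) ℝ) + ∑ i, vecMulVec (x i) (x i)
          - t • vecMulVec (∑ i, x i) (∑ i, x i)).det := by fun_prop
      have := this.measurable
      fun_prop
    have he := (volume_preserving_piFinSuccAbove (fun _ : Fin (n + 1) => Fin m → ℝ) 0).symm
    rw [← he.lintegral_comp hmeas, Measure.volume_eq_prod]
    refine (lintegral_prod_symm' _ (hmeas.comp he.measurable)).trans ?_
    simp only [Function.comp_apply]
    have hpt : ∀ (y : Fin n → Fin m → ℝ) (x : Fin m → ℝ),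
        a • (1 : Matrix (Fin m) (Fin m) ℝ)
          + ∑ i, vecMulVec ((MeasurableEquiv.piFinSuccAbove (fun _ => Fin m → ℝ) 0).symm (x, y) i)
            ((MeasurableEquiv.piFinSuccAbove (fun _ => Fin m → ℝ) 0).symm (x, y) i)
          - t • vecMulVec
            (∑ i, (MeasurableEquiv.piFinSuccAbove (fun _ => Fin m → ℝ) 0).symm (x, y) i)
            (∑ i, (MeasurableEquiv.piFinSuccAbove (fun _ => Fin m → ℝ) 0).symm (x, y) i)
        = (a • (1 : Matrix (Fin m) (Fin m) ℝ) + ∑ i, vecMulVec (y i) (y i)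
            - (t / (1 - t)) • vecMulVec (∑ i, y i) (∑ i, y i))
          + (1 - t) • vecMulVec (x - (t / (1 - t)) • ∑ i, y i)
              (x - (t / (1 - t)) • ∑ i, y i) := fun y x => by
      have := vecMulVec_self_sub_smul_vecMulVec_add ht1 x (∑ i, y i)
      simp only [MeasurableEquiv.piFinSuccAbove_symm_apply, Fin.insertNthEquiv_apply,
        Fin.insertNth_zero', Fin.sum_univ_succ, Fin.cons_zero, Fin.cons_succ]
      rw [← sub_eq_zero] at this ⊢
      rw [← this]
      abel
    have hexp : -((ν + (n + 1 : ℕ)) / 2) = -((ν + n + 1) / 2) := by push_cast; ring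
    have hexp' : 1 / 2 - (ν + n + 1) / 2 = -((ν + n) / 2) := by ring
    simp_rw [hpt, hexp]
    have hinner := fun y : Fin n → Fin m → ℝ => lintegral_det_add_smul_vecMulVec_rpow
      (posDef_smul_one_add_sum_vecMulVec_sub ha ht' hnt' y) h1t hs ((t / (1 - t)) • ∑ i, y i)
    simp_rw [hinner, hexp']
    rw [lintegral_const_mul' _ _ ENNReal.ofReal_ne_top, ih ht' hnt', ← ENNReal.ofReal_mul]
    · congr 1
      have : 1 - ((n + 1 : ℕ) : ℝ) * t = (1 - t) * (1 - n * (t / (1 - t))) := by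
        push_cast
        field_simp
        ring
      rw [this, Real.mul_rpow h1t.le (by linarith), Finset.prod_range_succ, pow_succ]
      ring
    · have h1 := Real.Gamma_pos_of_pos (sub_pos.2 hs)
      have h2 : 0 < Real.Gamma ((ν + n + 1) / 2) :=
        Real.Gamma_pos_of_pos (lt_of_le_of_lt (by positivity) hs)
      positivity

theorem multiGamma_pos {m : ℕ} {z : ℝ} (hz : ((m : ℝ) - 1) / 2 < z) : 0 < multiGamma m z := by
  refine mul_pos (by positivity) (Finset.prod_pos fun j _ => Real.Gamma_pos_of_pos ?_)
  have : (j : ℝ) + 1 ≤ m := by exact_mod_cast j.2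
  linarith

theorem multiGamma_mul_Gamma (m : ℕ) (z : ℝ) :
    multiGamma m z * Real.Gamma (z + 1 / 2)
      = multiGamma m (z + 1 / 2) * Real.Gamma (z + 1 / 2 - m / 2) := by
  unfold multiGamma
  rw [mul_assoc, mul_assoc, Fin.prod_univ_eq_prod_range (fun j => Real.Gamma (z - (j : ℝ) / 2)),
    Fin.prod_univ_eq_prod_range (fun j => Real.Gamma (z + 1 / 2 - (j : ℝ) / 2)),
    ← Finset.prod_range_succ (fun j => Real.Gamma (z + 1 / 2 - (j : ℝ) / 2)),
    Finset.prod_range_succ']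
  congr 3
  · refine funext fun j => congrArg Real.Gamma ?_
    push_cast
    ring
  · simp

theorem prod_Gamma_div_Gamma_eq_multiGamma_div (m n : ℕ) {ν : ℝ} (hν : (m : ℝ) - 1 < ν)
    (hν0 : 0 < ν) :
    ∏ k ∈ Finset.range n, Real.Gamma ((ν + k + 1) / 2 - m / 2) / Real.Gamma ((ν + k + 1) / 2)
      = multiGamma m (ν / 2) / multiGamma m ((ν + n) / 2) := by
  have hpos : ∀ k : ℕ, 0 < multiGamma m ((ν + k) / 2) := fun k => multiGamma_pos (by
    have : (0 : ℝ) ≤ k := k.cast_nonneg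
    linarith)
  induction n with
  | zero => simpa using (div_self (by simpa using (hpos 0).ne')).symm
  | succ n ih =>
    have hG : 0 < Real.Gamma ((ν + n + 1) / 2) := Real.Gamma_pos_of_pos (by positivity)
    have h1 := hpos n
    have h2 := hpos (n + 1)
    have h := multiGamma_mul_Gamma m ((ν + n) / 2)
    push_cast at h2 ⊢
    rw [show (ν + n) / 2 + 1 / 2 = (ν + n + 1) / 2 by ring] at h
    rw [← add_assoc] at h2 ⊢
    rw [Finset.prod_range_succ, ih, div_mul_div_comm, div_eq_div_iff (by positivity)
      (by positivity)]
    linear_combination (-multiGamma m (ν / 2)) * h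

theorem sigmaBar_eq_smul (m n : ℕ) {ν σ2 ρ2 : ℝ} (x : Fin n → Fin m → ℝ) :
    sigmaBar m n ν σ2 ρ2 x = (1 / (ν + n)) •
      ((ν * σ2) • (1 : Matrix (Fin m) (Fin m) ℝ) + ∑ i, vecMulVec (x i) (x i)
        - (1 / (ρ2 * ν + n)) • vecMulVec (∑ i, x i) (∑ i, x i)) := by
  have hsum : ∑ i, ∑ j, vecMulVec (x i) (x j) = vecMulVec (∑ i, x i) (∑ i, x i) := by
    ext k l
    simp [Matrix.sum_apply, vecMulVec_apply, Finset.sum_mul_sum]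
  rw [sigmaBar, hsum, smul_sub, smul_smul, div_mul_div_comm, one_mul, add_comm (n : ℝ) ν,
    add_comm (∑ i, vecMulVec (x i) (x i))]

/-- the full integral of `|Σ̄_n|^{-(ν+n)/2}` over all observations. -/
theorem sigmaBar_det_integral (m n : ℕ) (hm : 1 ≤ m) (hn : 1 ≤ n) (ν σ2 ρ2 : ℝ)
    (hν : (m : ℝ) - 1 < ν) (hσ : 0 < σ2) (hρ : 0 < ρ2) :
    ∫ x : Fin n → Fin m → ℝ, (sigmaBar m n ν σ2 ρ2 x).det ^ (-(ν + n) / 2)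
      = multiGamma m (ν / 2) * π ^ ((m : ℝ) * n / 2) *
          (ν + n) ^ ((m : ℝ) * (ν + n) / 2) * (1 + n / (ρ2 * ν)) ^ ((m : ℝ) / 2) /
        (σ2 ^ ((m : ℝ) * ν / 2) * multiGamma m ((ν + n) / 2) * ν ^ ((m : ℝ) * ν / 2)) := by
  have hm1 : (1 : ℝ) ≤ m := by exact_mod_cast hm
  have hn1 : (1 : ℝ) ≤ n := by exact_mod_cast hn
  have hν0 : 0 < ν := by linarith
  have hνn : 0 < ν + n := by linarith
  have hρν : 0 < ρ2 * ν := by positivity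
  have ha : 0 < ν * σ2 := by positivity
  have ht : 0 ≤ 1 / (ρ2 * ν + n) := by positivity
  have hnt : n * (1 / (ρ2 * ν + n)) < 1 := by
    rw [mul_one_div, div_lt_one (by positivity)]
    linarith
  have hG1 : 0 < multiGamma m (ν / 2) := multiGamma_pos (by linarith)
  have hG2 : 0 < multiGamma m ((ν + n) / 2) := multiGamma_pos (by linarith)
  have hdet := fun x : Fin n → Fin m → ℝ =>
    (posDef_smul_one_add_sum_vecMulVec_sub ha ht hnt x).det_pos
  have hpt : ∀ x : Fin n → Fin m → ℝ, (sigmaBar m n ν σ2 ρ2 x).det ^ (-(ν + n) / 2)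
      = (ν + n) ^ ((m : ℝ) * (ν + n) / 2) *
        ((ν * σ2) • (1 : Matrix (Fin m) (Fin m) ℝ) + ∑ i, vecMulVec (x i) (x i)
          - (1 / (ρ2 * ν + n)) • vecMulVec (∑ i, x i) (∑ i, x i)).det ^ (-((ν + n) / 2)) :=
    fun x => by
      rw [sigmaBar_eq_smul, det_smul, Fintype.card_fin, Real.mul_rpow (by positivity)
        (hdet x).le, ← Real.rpow_natCast, ← Real.rpow_mul (by positivity), one_div,
        Real.inv_rpow hνn.le, ← Real.rpow_neg hνn.le]
      congr 2 <;> ring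
  simp_rw [hpt]
  rw [integral_const_mul, integral_eq_lintegral_of_nonneg_ae,
    lintegral_det_smul_one_add_sum_vecMulVec_sub_rpow m hν ha n ht hnt,
    prod_Gamma_div_Gamma_eq_multiGamma_div m n hν hν0, ENNReal.toReal_ofReal]
  · have h1 : 1 - n * (1 / (ρ2 * ν + n)) = (1 + n / (ρ2 * ν))⁻¹ := by
      field_simp
      ring
    have h2 : (π ^ ((m : ℝ) / 2)) ^ n = π ^ ((m : ℝ) * n / 2) := by
      rw [← Real.rpow_natCast, ← Real.rpow_mul pi_pos.le]
      congr 1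
      ring
    rw [h1, h2, Real.inv_rpow (by positivity), neg_div, Real.rpow_neg (by positivity) ((m : ℝ) / 2),
      inv_inv, Real.rpow_neg ha.le, Real.mul_rpow hν0.le hσ.le]
    field_simp
  · have : 0 < 1 - n * (1 / (ρ2 * ν + n)) := sub_pos.2 hnt
    positivity
  · exact Filter.Eventually.of_forall fun x => Real.rpow_nonneg (hdet x).le _
  · have : Continuous fun x : Fin n → Fin m → ℝ =>
        ((ν * σ2) • (1 : Matrix (Fin m) (Fin m) ℝ) + ∑ i, vecMulVec (x i) (x i)
          - (1 / (ρ2 * ν + n)) • vecMulVec (∑ i, x i) (∑ i, x i)).det := by fun_prop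
    exact (this.measurable.pow_const _).aestronglyMeasurable
end
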